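/- Let G be a connected graph with a basis forced vertex v, and let H be obtained from G by attaching a pendant u to v. Then u is a basis forced vertex of H if and only if for every metric basis R of G there exists a vertex w ∈ N_G(v) such that d_H(r,w) = d_H(r,u) for all r ∈ R. -/

import Mathlib

open SimpleGraph

def isResolving {V : Type*} (G : SimpleGraph V) (S : Set V) : Prop :=
  ∀ x y : V, x ≠ y → ∃ s ∈ S, G.dist s x ≠ G.dist s y

noncomputable def metricDim {V : Type*} (G : SimpleGraph V) : ℕ :=
  sInf {n | ∃ S : Set V, isResolving G S ∧ S.ncard = n}

def isMetricBasis {V : Type*} (G : SimpleGraph V) (S : Set V) : Prop :=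
  isResolving G S ∧ S.ncard = metricDim G

def isBasisForced {V : Type*} (G : SimpleGraph V) (v : V) : Prop :=
  ∀ S : Set V, isMetricBasis G S → v ∈ S

def attachPendant {V : Type*} (G : SimpleGraph V) (v : V) : SimpleGraph (Option V) :=
  SimpleGraph.fromRel (fun x y =>
    (∃ a b, x = some a ∧ y = some b ∧ G.Adj a b) ∨ (x = some v ∧ y = none))


lemma ap_some {V : Type*} (G : SimpleGraph V) (v a b : V) :
    (attachPendant G v).Adj (some a) (some b) ↔ G.Adj a b := by
  simp only [attachPendant, SimpleGraph.fromRel_adj]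
  constructor
  · rintro ⟨_, h⟩
    rcases h with (⟨c, d, hc, hd, h⟩ | ⟨_, h⟩) | (⟨c, d, hc, hd, h⟩ | ⟨_, h⟩)
    · cases hc; cases hd; exact h
    · cases h
    · cases hc; cases hd; exact h.symm
    · cases h
  · intro h
    exact ⟨fun e => h.ne (Option.some.inj e), Or.inl (Or.inl ⟨a, b, rfl, rfl, h⟩)⟩

lemma ap_none {V : Type*} (G : SimpleGraph V) (v a : V) :
    (attachPendant G v).Adj (some a) none ↔ a = v := by
  simp [attachPendant, SimpleGraph.fromRel_adj]

noncomputable def apPot {V : Type*} (G : SimpleGraph V) (v a : V) : Option V → ℕ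
  | some x => G.dist a x
  | none => G.dist a v + 1

lemma apPot_adj {V : Type*} (G : SimpleGraph V) (hG : G.Connected) (v a : V) (x y : Option V)
    (h : (attachPendant G v).Adj x y) : apPot G v a y ≤ apPot G v a x + 1 := by
  cases x with
  | none =>
    cases y with
    | none => exact absurd h (SimpleGraph.irrefl _)
    | some y =>
      have := (ap_none G v y).1 h.symm
      subst this
      simp only [apPot]; omega
  | some x =>
    cases y with
    | none =>
      have := (ap_none G v x).1 h
      subst this
      simp only [apPot]; omega
    | some y =>
      have h1 := (ap_some G v x y).1 h
      have h2 := hG.dist_triangle (u := a) (v := x) (w := y)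
      have h3 := SimpleGraph.dist_eq_one_iff_adj.2 h1
      simp only [apPot]; omega

lemma apPot_walk {V : Type*} (G : SimpleGraph V) (hG : G.Connected) (v a : V) (x y : Option V)
    (p : (attachPendant G v).Walk x y) : apPot G v a y ≤ apPot G v a x + p.length := by
  induction p with
  | nil => simp
  | cons h p ih =>
    have := apPot_adj G hG v a _ _ h
    simp only [SimpleGraph.Walk.length_cons]; omega

def apHom {V : Type*} (G : SimpleGraph V) (v : V) : G →g attachPendant G v where
  toFun := some
  map_rel' := fun h => (ap_some G v _ _).2 h

lemma ap_dist_some {V : Type*} (G : SimpleGraph V) (hG : G.Connected) (v a b : V) :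
    (attachPendant G v).dist (some a) (some b) = G.dist a b := by
  obtain ⟨p, hp⟩ := hG.exists_walk_length_eq_dist a b
  let q : (attachPendant G v).Walk (some a) (some b) := p.map (apHom G v)
  apply le_antisymm
  · rw [← hp]
    have : q.length = p.length := SimpleGraph.Walk.length_map _ _
    rw [← this]
    exact SimpleGraph.dist_le q
  · obtain ⟨r, hr⟩ := (SimpleGraph.Walk.reachable q).exists_walk_length_eq_dist
    have := apPot_walk G hG v a _ _ r
    simp only [apPot, SimpleGraph.dist_self] at this
    omega

lemma ap_dist_none {V : Type*} (G : SimpleGraph V) (hG : G.Connected) (v a : V) :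
    (attachPendant G v).dist (some a) none = G.dist a v + 1 := by
  obtain ⟨p, hp⟩ := hG.exists_walk_length_eq_dist a v
  let q' : (attachPendant G v).Walk (some a) (some v) := p.map (apHom G v)
  let q := q'.concat ((ap_none G v v).2 rfl)
  apply le_antisymm
  · rw [← hp]
    have h1 : q'.length = p.length := SimpleGraph.Walk.length_map _ _
    have h2 : q.length = q'.length + 1 := SimpleGraph.Walk.length_concat _ _
    rw [← h1, ← h2]
    exact SimpleGraph.dist_le q
  · obtain ⟨r, hr⟩ := (SimpleGraph.Walk.reachable q).exists_walk_length_eq_dist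
    have := apPot_walk G hG v a _ _ r
    simp only [apPot, SimpleGraph.dist_self] at this
    omega

lemma ap_dist_none_left {V : Type*} (G : SimpleGraph V) (hG : G.Connected) (v a : V) :
    (attachPendant G v).dist none (some a) = G.dist v a + 1 := by
  rw [SimpleGraph.dist_comm, ap_dist_none G hG, SimpleGraph.dist_comm]

lemma metricDim_le {V : Type*} (G : SimpleGraph V) (S : Set V) (h : isResolving G S) :
    metricDim G ≤ S.ncard := Nat.sInf_le ⟨S, h, rfl⟩

lemma exists_basis {V : Type*} (G : SimpleGraph V) (hG : G.Connected) :
    ∃ S, isMetricBasis G S := by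
  have : (metricDim G) ∈ {n | ∃ S : Set V, isResolving G S ∧ S.ncard = n} := by
    apply Nat.sInf_mem
    refine ⟨_, Set.univ, ?_, rfl⟩
    intro x y hxy
    refine ⟨x, trivial, ?_⟩
    rw [SimpleGraph.dist_self]
    exact (hG.pos_dist_of_ne hxy).ne
  exact this

lemma ap_connected {V : Type*} (G : SimpleGraph V) (hG : G.Connected) (v : V) :
    (attachPendant G v).Connected := by
  have key : ∀ x, (attachPendant G v).Reachable (some v) x := by
    intro x
    cases x with
    | none => exact SimpleGraph.Adj.reachable ((ap_none G v v).2 rfl)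
    | some x => exact (hG v x).map (apHom G v)
  have : Nonempty (Option V) := ⟨none⟩
  exact SimpleGraph.Connected.mk (fun x y => (key x).symm.trans (key y))

/-- projection of a resolving set -/
lemma resolving_proj {V : Type*} [Fintype V] (G : SimpleGraph V) (hG : G.Connected) (v : V)
    (S : Set (Option V)) (hS : isResolving (attachPendant G v) S) :
    isResolving G ((fun x : Option V => x.getD v) '' S) := by
  intro x y hxy
  obtain ⟨s, hs, h⟩ := hS (some x) (some y) (fun e => hxy (Option.some.inj e))
  refine ⟨s.getD v, ⟨s, hs, rfl⟩, ?_⟩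
  cases s with
  | none =>
    rw [ap_dist_none_left G hG, ap_dist_none_left G hG] at h
    simp only [Option.getD_none]
    omega
  | some s =>
    rw [ap_dist_some G hG, ap_dist_some G hG] at h
    exact h

lemma metricDim_eq {V : Type*} [Fintype V] (G : SimpleGraph V) (hG : G.Connected)
    (v : V) (hv : isBasisForced G v) : metricDim (attachPendant G v) = metricDim G := by
  classical
  apply le_antisymm
  · obtain ⟨R, hR⟩ := exists_basis G hG
    let f : V → Option V := fun x => if x = v then none else some x
    have hr : isResolving (attachPendant G v) (f '' R) := by
      have hn : none ∈ f '' R := ⟨v, hv R hR, by simp [f]⟩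
      have hc := ap_connected G hG v
      intro x y hxy
      cases x with
      | none =>
        refine ⟨none, hn, ?_⟩
        rw [SimpleGraph.dist_self]
        exact (hc.pos_dist_of_ne hxy).ne
      | some x =>
        cases y with
        | none =>
          refine ⟨none, hn, ?_⟩
          rw [SimpleGraph.dist_self]
          exact (hc.pos_dist_of_ne hxy.symm).ne'
        | some y =>
          obtain ⟨s, hs, h⟩ := hR.1 x y (fun e => hxy (congrArg some e))
          refine ⟨f s, ⟨s, hs, rfl⟩, ?_⟩
          by_cases hsv : s = v
          · subst hsv
            simp only [f, if_true]
            rw [ap_dist_none_left G hG, ap_dist_none_left G hG]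
            omega
          · simp only [f, if_neg hsv]
            rw [ap_dist_some G hG, ap_dist_some G hG]
            exact h
    calc _ ≤ _ := metricDim_le _ _ hr
      _ ≤ R.ncard := Set.ncard_image_le (Set.toFinite _)
      _ = _ := hR.2
  · obtain ⟨S, hS⟩ := exists_basis _ (ap_connected G hG v)
    calc _ ≤ _ := metricDim_le _ _ (resolving_proj G hG v S hS.1)
      _ ≤ S.ncard := Set.ncard_image_le (Set.toFinite _)
      _ = _ := hS.2

theorem stmt1 {V : Type*} [Fintype V] (G : SimpleGraph V) (hG : G.Connected)
    (v : V) (hv : isBasisForced G v) :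
    isBasisForced (attachPendant G v) none ↔
      ∀ R : Set V, isMetricBasis G R → ∃ w : V, G.Adj v w ∧
        ∀ r ∈ R, (attachPendant G v).dist (some r) (some w)
          = (attachPendant G v).dist (some r) (none : Option V) := by
  have hdim := metricDim_eq G hG v hv
  constructor
  · intro hf R hR
    by_contra hcon
    have hres : isResolving (attachPendant G v) (some '' R) := by
      have key : ∀ w : V, ∃ r ∈ R, (attachPendant G v).dist (some r) (some w)
          ≠ (attachPendant G v).dist (some r) (none : Option V) := by
        intro w
        by_contra hw
        push Not at hw
        refine hcon ⟨w, ?_, hw⟩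
        have := hw v (hv R hR)
        rw [ap_dist_some G hG, ap_dist_none G hG, SimpleGraph.dist_self] at this
        exact SimpleGraph.dist_eq_one_iff_adj.1 this
      intro x y hxy
      cases x with
      | none =>
        cases y with
        | none => exact absurd rfl hxy
        | some y =>
          obtain ⟨r, hr, h⟩ := key y
          exact ⟨some r, ⟨r, hr, rfl⟩, h.symm⟩
      | some x =>
        cases y with
        | none =>
          obtain ⟨r, hr, h⟩ := key x
          exact ⟨some r, ⟨r, hr, rfl⟩, h⟩
        | some y =>
          obtain ⟨s, hs, h⟩ := hR.1 x y (fun e => hxy (congrArg some e))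
          refine ⟨some s, ⟨s, hs, rfl⟩, ?_⟩
          rw [ap_dist_some G hG, ap_dist_some G hG]
          exact h
    have := hf (some '' R) ⟨hres, by
      rw [hdim, Set.ncard_image_of_injective _ (Option.some_injective V)]; exact hR.2⟩
    obtain ⟨r, _, h⟩ := this
    cases h
  · intro h S hS
    by_contra hn
    let R := (fun x : Option V => x.getD v) '' S
    have hRr : isResolving G R := resolving_proj G hG v S hS.1
    have hR : isMetricBasis G R := by
      refine ⟨hRr, le_antisymm ?_ (metricDim_le _ _ hRr)⟩
      rw [← hdim, ← hS.2]
      exact Set.ncard_image_le (Set.toFinite _)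
    obtain ⟨w, _, hw⟩ := h R hR
    obtain ⟨s, hs, hd⟩ := hS.1 (some w) none (by simp)
    cases s with
    | none => exact hn hs
    | some s => exact hd (hw s ⟨some s, hs, rfl⟩)
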